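/- (Principal specialization / hook-content formula) For a partition λ and a positive integer z, the Schur function evaluated at z ones equals Π_{□∈λ} (z + c(□))/h(□), where c(□) is the content and h(□) the hook length of the box □. -/

import Mathlib

open MvPolynomial Finset

/-- `h_k` with integer index, `h_k = 0` for `k < 0`. -/
noncomputable def hInt (n : ℕ) (k : ℤ) : MvPolynomial (Fin n) ℚ :=
  if 0 ≤ k then hsymm (Fin n) ℚ k.toNat else 0

/-- The Schur polynomial of the partition with part function `f` (0-indexed, with all
parts of index `≥ N` zero) in `n` variables, via the Jacobi–Trudi determinant of size
`Σ_{i<N} f i ≥ ℓ(λ)`. -/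
noncomputable def schurF (n N : ℕ) (f : ℕ → ℕ) : MvPolynomial (Fin n) ℚ :=
  Matrix.det (Matrix.of fun i j : Fin (∑ i ∈ Finset.range N, f i) =>
    hInt n ((f i : ℤ) + (j : ℤ) - (i : ℤ)))

/-- `h_k(1, …, 1)` as a function of the number `x` of variables, which may be any rational. -/
noncomputable def hOnes (x : ℚ) (k : ℤ) : ℚ :=
  if 0 ≤ k then (ascPochhammer ℚ k.toNat).eval x / (k.toNat.factorial : ℚ) else 0

lemma eval_one_hsymm (z k : ℕ) :
    MvPolynomial.eval (fun _ => (1 : ℚ)) (hsymm (Fin z) ℚ k) =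
      (ascPochhammer ℚ k).eval (z : ℚ) / (k.factorial : ℚ) := by
  have h1 : MvPolynomial.eval (fun _ => (1 : ℚ)) (hsymm (Fin z) ℚ k) =
      (Nat.multichoose z k : ℚ) := by
    rw [hsymm, map_sum]
    simp only [map_multiset_prod, Multiset.map_map, Function.comp_def, eval_X, Multiset.map_const',
      Multiset.prod_replicate, one_pow, sum_const, nsmul_eq_mul, mul_one]
    rw [Finset.card_univ, Sym.card_sym_eq_multichoose, Fintype.card_fin]
  rw [h1, eq_div_iff (by positivity), ← Nat.cast_ascFactorial,
    Nat.ascFactorial_eq_factorial_mul_choose', Nat.multichoose_eq]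
  push_cast
  ring

lemma eval_one_hInt (z : ℕ) (k : ℤ) :
    MvPolynomial.eval (fun _ => (1 : ℚ)) (hInt z k) = hOnes z k := by
  unfold hInt hOnes
  split_ifs
  · exact eval_one_hsymm z _
  · simp

lemma hOnes_succ_sub (x : ℚ) (k : ℤ) : hOnes x (k + 1) - hOnes x k = hOnes (x - 1) (k + 1) := by
  rcases lt_trichotomy k (-1) with h | rfl | h
  · simp [hOnes, show ¬ 0 ≤ k + 1 by omega, show ¬ 0 ≤ k by omega]
  · simp [hOnes]
  · obtain ⟨n, rfl⟩ := Int.eq_ofNat_of_zero_le (show 0 ≤ k by omega)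
    have e : ((n : ℤ) + 1).toNat = n + 1 := by omega
    have h2 : (ascPochhammer ℚ (n + 1)).eval (x - 1) = (x - 1) * (ascPochhammer ℚ n).eval x := by
      rw [ascPochhammer_succ_left]
      simp [Polynomial.eval_comp]
    have hn : (n.factorial : ℚ) ≠ 0 := by positivity
    simp only [hOnes, show (0 : ℤ) ≤ n + 1 by omega, show (0 : ℤ) ≤ n by omega, if_true, e,
      Int.toNat_natCast, h2, ascPochhammer_succ_eval, Nat.factorial_succ]
    push_cast
    field_simp
    ring

lemma fwdDiff_iter_hOnes (x : ℚ) (m : ℕ) (k : ℤ) :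
    (fwdDiff (1 : ℤ))^[m] (hOnes x) k = hOnes (x - m) (k + m) := by
  induction m generalizing k with
  | zero => simp
  | succ m ih =>
    rw [Function.iterate_succ_apply', fwdDiff, ih, ih, add_right_comm, hOnes_succ_sub]
    push_cast
    congr 1 <;> ring

lemma hOnes_sub_eq_sum (x : ℚ) (m : ℕ) (k : ℤ) :
    hOnes (x - m) (k + m) =
      ∑ j ∈ range (m + 1), hOnes x (k + j) * ((-1) ^ (m - j) * (m.choose j : ℚ)) := by
  rw [← fwdDiff_iter_hOnes, fwdDiff_iter_eq_sum_shift]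
  refine sum_congr rfl fun j _ => ?_
  simp [mul_comm]

lemma det_hOnes_eq_det_shift (x : ℚ) {M : ℕ} (a : Fin M → ℤ) :
    (Matrix.of fun i j : Fin M => hOnes x (a i + (j : ℕ))).det =
      (Matrix.of fun i j : Fin M => hOnes (x - (j : ℕ)) (a i + (j : ℕ))).det := by
  set U : Matrix (Fin M) (Fin M) ℚ :=
    Matrix.of fun j m => (-1) ^ ((m : ℕ) - j) * ((m : ℕ).choose j : ℚ) with hU
  have hdet : U.det = 1 := by
    rw [Matrix.det_of_isUpperTriangular]
    · simp [hU]
    · intro i j hij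
      have : (j : ℕ) < i := hij
      simp [hU, Nat.choose_eq_zero_of_lt this]
  rw [← mul_one (Matrix.det _), ← hdet, ← Matrix.det_mul]
  congr 1
  ext i m
  rw [Matrix.mul_apply]
  simp only [Matrix.of_apply, hU]
  rw [hOnes_sub_eq_sum, Fin.sum_univ_eq_sum_range
    (fun j => hOnes x (a i + j) * ((-1) ^ ((m : ℕ) - j) * ((m : ℕ).choose j : ℚ))) M]
  refine (sum_subset (range_subset_range.2 m.2) fun j _ hj => ?_).symm
  rw [Nat.choose_eq_zero_of_lt (by simpa using hj)]
  simp

lemma ascPochhammer_eval_add (w : ℚ) (m n : ℕ) :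
    (ascPochhammer ℚ (m + n)).eval w =
      (ascPochhammer ℚ m).eval w * (ascPochhammer ℚ n).eval (w + m) := by
  rw [← ascPochhammer_mul]
  simp [Polynomial.eval_comp]

lemma hOnes_mul_ascPochhammer (w : ℚ) (l j : ℕ) :
    hOnes (w + j) ((l : ℤ) - j) * (ascPochhammer ℚ j).eval w =
      (ascPochhammer ℚ l).eval w / (l.factorial : ℚ) * (descPochhammer ℚ j).eval (l : ℚ) := by
  rw [descPochhammer_eval_eq_descFactorial]
  rcases le_or_gt j l with h | h
  · obtain ⟨n, rfl⟩ := Nat.exists_eq_add_of_le h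
    have e : ((j + n : ℕ) : ℤ) - j = n := by push_cast; ring
    have h1 := Nat.factorial_mul_descFactorial h
    rw [Nat.add_sub_cancel_left] at h1
    have hn : (n.factorial : ℚ) ≠ 0 := by positivity
    have hd : ((j + n).descFactorial j : ℚ) ≠ 0 := by
      exact_mod_cast (Nat.descFactorial_pos.2 h).ne'
    rw [e, hOnes, if_pos (by omega), Int.toNat_natCast, ascPochhammer_eval_add, ← h1]
    push_cast
    field_simp
  · rw [hOnes, if_neg (by omega), Nat.descFactorial_of_lt h]
    simp

lemma det_descPochhammer_rev {M : ℕ} (v : Fin M → ℚ) :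
    (Matrix.of fun i j : Fin M => (descPochhammer ℚ (j.rev : ℕ)).eval (v i)).det =
      ∏ i, ∏ j ∈ Ioi i, (v i - v j) := by
  have h := Matrix.det_eval_matrixOfPolynomials_eq_det_vandermonde v
    (fun j => descPochhammer ℚ (j : ℕ)) (fun j => descPochhammer_natDegree ℚ j)
    (fun j => monic_descPochhammer ℚ j)
  have h1 := Matrix.det_permute' (Fin.revPerm (n := M))
    (Matrix.of fun i j : Fin M => (descPochhammer ℚ (j : ℕ)).eval (v i))
  have h2 := Matrix.det_permute' (Fin.revPerm (n := M)) (Matrix.vandermonde v)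
  rw [← h, ← h2] at h1
  refine h1.trans ?_
  have h3 : (Matrix.vandermonde v).submatrix id (Fin.revPerm (n := M)) =
      Matrix.projVandermonde 1 v := by
    ext i j
    simp [Matrix.projVandermonde_apply, Matrix.vandermonde_apply]
  rw [h3, Matrix.det_projVandermonde]
  simp

/-- The product formula for the Jacobi–Trudi determinant at `z ≥ M` ones. -/
lemma det_hOnes_of_le (f : ℕ → ℕ) {M z : ℕ} (hz : M ≤ z) :
    (Matrix.of fun i j : Fin M => hOnes z ((f i : ℤ) + (j : ℕ) - (i : ℕ))).det =
      ∏ i : Fin M, ((ascPochhammer ℚ (f i)).eval ((z : ℚ) - (i : ℕ)) /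
        ((f i + i.rev : ℕ).factorial : ℚ) *
          ∏ k ∈ Ioi i, (((f i + i.rev : ℕ) : ℚ) - ((f k + k.rev : ℕ) : ℚ))) := by
  set w : ℚ := z - M + 1 with hw
  have hwpos : 0 < w := by
    have : (M : ℚ) ≤ z := by exact_mod_cast hz
    linarith
  have hrev (j : Fin M) : ((j.rev : ℕ) : ℚ) = M - 1 - (j : ℕ) := by
    have : (j.rev : ℕ) + j + 1 = M := by rw [Fin.val_rev]; omega
    have : ((j.rev : ℕ) : ℚ) + (j : ℕ) + 1 = M := by exact_mod_cast this
    linarith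
  have hs (j : Fin M) : (ascPochhammer ℚ (j.rev : ℕ)).eval w ≠ 0 :=
    (ascPochhammer_pos _ _ hwpos).ne'
  have h1 : (Matrix.of fun i j : Fin M => hOnes z ((f i : ℤ) + (j : ℕ) - (i : ℕ))).det =
      (Matrix.of fun i j : Fin M =>
        ((ascPochhammer ℚ (f i + i.rev)).eval w / ((f i + i.rev : ℕ).factorial : ℚ)) *
        (Matrix.of fun i j : Fin M => ((ascPochhammer ℚ (j.rev : ℕ)).eval w)⁻¹ *
        (Matrix.of fun i j : Fin M => (descPochhammer ℚ (j.rev : ℕ)).eval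
          ((f i + i.rev : ℕ) : ℚ)) i j) i j).det := by
    have h0 := det_hOnes_eq_det_shift (z : ℚ) (fun i : Fin M => (f i : ℤ) - (i : ℕ))
    simp only [sub_add_eq_add_sub] at h0
    rw [h0]
    congr 1
    ext i j
    simp only [Matrix.of_apply]
    rw [mul_left_comm, ← hOnes_mul_ascPochhammer, mul_comm, mul_assoc, mul_inv_cancel₀ (hs j),
      mul_one]
    congr 1
    · rw [hrev, hw]; ring
    · rw [Fin.val_rev, Fin.val_rev]; omega
  rw [h1, Matrix.det_mul_column, Matrix.det_mul_row, det_descPochhammer_rev, ← mul_assoc,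
    ← prod_mul_distrib, ← prod_mul_distrib]
  refine prod_congr rfl fun i _ => ?_
  congr 1
  rw [add_comm (f i), ascPochhammer_eval_add, hrev, hw,
    show (z : ℚ) - M + 1 + (M - 1 - (i : ℕ)) = z - (i : ℕ) by ring, ← hw]
  have := hs i
  field_simp

/-- The product formula for the Jacobi–Trudi determinant at any number of ones. -/
lemma det_hOnes (f : ℕ → ℕ) (M : ℕ) (x : ℚ) :
    (Matrix.of fun i j : Fin M => hOnes x ((f i : ℤ) + (j : ℕ) - (i : ℕ))).det =
      ∏ i : Fin M, ((ascPochhammer ℚ (f i)).eval (x - (i : ℕ)) /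
        ((f i + i.rev : ℕ).factorial : ℚ) *
          ∏ k ∈ Ioi i, (((f i + i.rev : ℕ) : ℚ) - ((f k + k.rev : ℕ) : ℚ))) := by
  let hPoly : ℤ → Polynomial ℚ := fun k =>
    if 0 ≤ k then ascPochhammer ℚ k.toNat * Polynomial.C (k.toNat.factorial : ℚ)⁻¹ else 0
  have hPoly_eval (k : ℤ) (y : ℚ) : (hPoly k).eval y = hOnes y k := by
    simp only [hPoly, hOnes]
    split_ifs
    · rw [Polynomial.eval_mul, Polynomial.eval_C, div_eq_mul_inv]
    · simp
  let P : Polynomial ℚ :=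
    (Matrix.of fun i j : Fin M => hPoly ((f i : ℤ) + (j : ℕ) - (i : ℕ))).det
  let Q : Polynomial ℚ :=
    ∏ i : Fin M, ((ascPochhammer ℚ (f i)).comp (Polynomial.X - Polynomial.C ((i : ℕ) : ℚ)) *
      Polynomial.C (((f i + i.rev : ℕ).factorial : ℚ)⁻¹ *
          ∏ k ∈ Ioi i, (((f i + i.rev : ℕ) : ℚ) - ((f k + k.rev : ℕ) : ℚ))))
  have hP (y : ℚ) : P.eval y =
      (Matrix.of fun i j : Fin M => hOnes y ((f i : ℤ) + (j : ℕ) - (i : ℕ))).det := by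
    rw [← Polynomial.coe_evalRingHom, RingHom.map_det]
    congr 1
    ext i j
    simp [hPoly_eval]
  have hQ (y : ℚ) : Q.eval y =
      ∏ i : Fin M, ((ascPochhammer ℚ (f i)).eval (y - (i : ℕ)) /
        ((f i + i.rev : ℕ).factorial : ℚ) *
          ∏ k ∈ Ioi i, (((f i + i.rev : ℕ) : ℚ) - ((f k + k.rev : ℕ) : ℚ))) := by
    simp only [Q, Polynomial.eval_prod]
    refine prod_congr rfl fun i _ => ?_
    rw [Polynomial.eval_mul, Polynomial.eval_comp, Polynomial.eval_C, Polynomial.eval_sub,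
      Polynomial.eval_X, Polynomial.eval_C, div_eq_mul_inv, mul_assoc]
  have hPQ : P = Q := by
    refine Polynomial.eq_of_infinite_eval_eq P Q ?_
    refine ((Set.Ici_infinite M).image (Nat.cast_injective (R := ℚ)).injOn).mono ?_
    rintro _ ⟨z, hz, rfl⟩
    exact (hP z).trans ((det_hOnes_of_le f hz).trans (hQ z).symm)
  rw [← hP, ← hQ, hPQ]

lemma prod_Icc_one_eq_factorial (n : ℕ) : ∏ x ∈ Icc 1 n, x = n.factorial := by
  induction n with
  | zero => simp
  | succ n ih => rw [prod_Icc_succ_top (by omega), ih, Nat.factorial_succ, mul_comm]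

/-- In row `i` of a partition, the hook lengths `f i - j + (c j - i - 1)` and the differences
`f i - f k + (k - i)` for `i < k < M` together make up `1, …, f i + (M - 1 - i)`. -/
lemma prod_hooks_mul_prod_differences {f c : ℕ → ℕ} (hf : Antitone f)
    (hc : ∀ r j, j < f r ↔ r < c j) {i M : ℕ} (hi : i < M) (hM : f M = 0) :
    (∏ j ∈ range (f i), (f i - j + (c j - i - 1))) * ∏ k ∈ Ioo i M, (f i - f k + (k - i)) =
      (f i + (M - 1 - i)).factorial := by
  have hcanti {j j' : ℕ} (h : j ≤ j') : c j' ≤ c j := by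
    by_contra! hlt
    exact absurd ((hc _ _).1 (h.trans_lt ((hc _ _).2 hlt))) (lt_irrefl _)
  have hH : Set.InjOn (fun j => f i - j + (c j - i - 1)) (range (f i)) := by
    intro a ha b hb hab
    simp only [coe_range, Set.mem_Iio] at ha hb hab
    have h1 := (hc _ _).1 ha
    have h2 := (hc _ _).1 hb
    rcases lt_trichotomy a b with h | h | h
    · have := hcanti h.le; omega
    · exact h
    · have := hcanti h.le; omega
  have hD : Set.InjOn (fun k => f i - f k + (k - i)) (Ioo i M) := by
    intro a ha b hb hab
    simp only [coe_Ioo, Set.mem_Ioo] at ha hb hab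
    have h1 := hf ha.1.le
    have h2 := hf hb.1.le
    rcases lt_trichotomy a b with h | h | h
    · have := hf h.le; omega
    · exact h
    · have := hf h.le; omega
  have hdisj : Disjoint ((range (f i)).image fun j => f i - j + (c j - i - 1))
      ((Ioo i M).image fun k => f i - f k + (k - i)) := by
    rw [disjoint_left]
    intro x hx hy
    obtain ⟨j, hj, rfl⟩ := mem_image.1 hx
    obtain ⟨k, hk, h⟩ := mem_image.1 hy
    rw [mem_range] at hj
    rw [mem_Ioo] at hk
    have h1 := (hc _ _).1 hj
    have h2 := hf hk.1.le
    have h3 := hc k j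
    omega
  have hunion : ((range (f i)).image fun j => f i - j + (c j - i - 1)) ∪
      ((Ioo i M).image fun k => f i - f k + (k - i)) = Icc 1 (f i + (M - 1 - i)) := by
    refine eq_of_subset_of_card_le ?_ ?_
    · intro x hx
      rw [mem_Icc]
      rcases mem_union.1 hx with h | h
      · obtain ⟨j, hj, rfl⟩ := mem_image.1 h
        rw [mem_range] at hj
        have h1 := (hc _ _).1 hj
        have h2 := hc M j
        omega
      · obtain ⟨k, hk, rfl⟩ := mem_image.1 h
        rw [mem_Ioo] at hk
        omega
    · rw [card_union_of_disjoint hdisj, card_image_of_injOn hH, card_image_of_injOn hD]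
      simp
      omega
  rw [← prod_Icc_one_eq_factorial, ← hunion, prod_union hdisj, prod_image hH, prod_image hD]

/-- The number of rows of length greater than `j` is the length of column `j`. -/
lemma lt_iff_lt_card_filter {f : ℕ → ℕ} (hf : Antitone f) {N : ℕ} (hN : ∀ n ≥ N, f n = 0)
    (r j : ℕ) : j < f r ↔ r < ((range N).filter fun s => j < f s).card := by
  constructor
  · intro h
    have hrN : r < N := by
      by_contra! hr
      rw [hN r hr] at h
      omega
    have hsub : range (r + 1) ⊆ (range N).filter fun s => j < f s := by
      intro s hs
      rw [mem_range] at hs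
      exact mem_filter.2 ⟨mem_range.2 (by omega), h.trans_le (hf (by omega))⟩
    simpa using card_le_card hsub
  · intro h
    by_contra! hr
    have hsub : ((range N).filter fun s => j < f s) ⊆ range r := by
      intro s hs
      rw [mem_range]
      by_contra! hs'
      exact absurd (mem_filter.1 hs).2 (not_lt.2 ((hf hs').trans hr))
    have := card_le_card hsub
    rw [card_range] at this
    omega

lemma eq_zero_of_sum_le {f : ℕ → ℕ} (hf : Antitone f) {N : ℕ} (hN : ∀ n ≥ N, f n = 0)
    {n : ℕ} (hn : ∑ i ∈ range N, f i ≤ n) : f n = 0 := by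
  by_contra h
  have hnN : n < N := by
    by_contra! hr
    exact h (hN n hr)
  have h1 : ∑ i ∈ range (n + 1), 1 ≤ ∑ i ∈ range (n + 1), f i := by
    refine sum_le_sum fun i hi => ?_
    have := hf (show i ≤ n from Nat.lt_succ_iff.1 (mem_range.1 hi))
    omega
  have h2 : ∑ i ∈ range (n + 1), f i ≤ ∑ i ∈ range N, f i :=
    sum_le_sum_of_subset (range_subset_range.2 hnN)
  simp at h1
  omega

lemma prod_range_eq_prod_range_of_eq_one {g : ℕ → ℚ} {m n : ℕ} (hm : ∀ i ≥ m, g i = 1)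
    (hn : ∀ i ≥ n, g i = 1) : ∏ i ∈ range m, g i = ∏ i ∈ range n, g i := by
  rcases le_total m n with h | h
  · exact prod_subset (range_subset_range.2 h) fun i _ hi => hm i (by simpa using hi)
  · exact (prod_subset (range_subset_range.2 h) fun i _ hi => hn i (by simpa using hi)).symm

lemma ascPochhammer_eval_eq_prod (n : ℕ) (x : ℚ) :
    (ascPochhammer ℚ n).eval x = ∏ j ∈ range n, (x + j) := by
  induction n with
  | zero => simp
  | succ n ih => rw [ascPochhammer_succ_eval, prod_range_succ, ih]

lemma row_factor_eq {f c : ℕ → ℕ} (hf : Antitone f) (hc : ∀ r j, j < f r ↔ r < c j) {M : ℕ}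
    (hM : f M = 0) (x : ℚ) (i : Fin M) :
    (ascPochhammer ℚ (f i)).eval (x - (i : ℕ)) / ((f i + i.rev : ℕ).factorial : ℚ) *
        ∏ k ∈ Ioi i, (((f i + i.rev : ℕ) : ℚ) - ((f k + k.rev : ℕ) : ℚ)) =
      ∏ j ∈ range (f i), (x + ((j : ℚ) - (i : ℕ))) /
        ((f i : ℚ) - j + (c j : ℚ) - (i : ℕ) - 1) := by
  have hrow := prod_hooks_mul_prod_differences hf hc i.2 hM
  have hdiff : ∏ k ∈ Ioi i, (((f i + i.rev : ℕ) : ℚ) - ((f k + k.rev : ℕ) : ℚ)) =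
      ((∏ k ∈ Ioo (i : ℕ) M, (f i - f k + (k - i)) : ℕ) : ℚ) := by
    rw [← Fin.map_valEmbedding_Ioi, prod_map, Nat.cast_prod]
    refine prod_congr rfl fun k hk => ?_
    have hik : (i : ℕ) < k := Fin.lt_def.1 (mem_Ioi.1 hk)
    have h1 := hf hik.le
    rw [sub_eq_iff_eq_add, ← Nat.cast_add, Nat.cast_inj, Fin.val_rev, Fin.val_rev]
    simp only [Fin.valEmbedding_apply]
    omega
  have hhook : ∏ j ∈ range (f i), ((f i : ℚ) - j + (c j : ℚ) - (i : ℕ) - 1) =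
      ((∏ j ∈ range (f i), (f i - j + (c j - i - 1)) : ℕ) : ℚ) := by
    rw [Nat.cast_prod]
    refine prod_congr rfl fun j hj => ?_
    have h1 := mem_range.1 hj
    have h2 := (hc _ _).1 h1
    have h3 : f i - j + (c j - i - 1) + j + i + 1 = f i + c j := by omega
    have h4 : ((f i - j + (c j - i - 1) : ℕ) : ℚ) + j + (i : ℕ) + 1 = f i + c j := by
      exact_mod_cast h3
    linarith
  have hfac : (f i + i.rev : ℕ) = f i + (M - 1 - i) := by rw [Fin.val_rev]; omega
  have hne : (∏ j ∈ range (f i), (f i - j + (c j - i - 1))) *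
      ∏ k ∈ Ioo (i : ℕ) M, (f i - f k + (k - i)) ≠ 0 := by
    rw [hrow]
    exact Nat.factorial_ne_zero _
  rw [prod_div_distrib, hhook, hdiff, hfac, ← hrow, ascPochhammer_eval_eq_prod, Nat.cast_mul]
  have hne1 := Nat.cast_ne_zero (R := ℚ).2 (left_ne_zero_of_mul hne)
  have hne2 := Nat.cast_ne_zero (R := ℚ).2 (right_ne_zero_of_mul hne)
  rw [div_mul_eq_mul_div, mul_div_mul_right _ _ hne2]
  congr 1
  exact prod_congr rfl fun j _ => by ring

/-- Hook-content formula: for a partition `λ` and a positive integer `z`, the Schur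
polynomial in `z` variables evaluated at `z` ones equals
`Π_{□∈λ} (z + c(□))/h(□)` where, for the (0-indexed) box `(i,j)`, the content is
`c = j - i` and the hook length is `h = λ_i - j + λ'_j - i - 1`. -/
theorem hook_content_formula (f : ℕ → ℕ) (hf : Antitone f) (N : ℕ)
    (hN : ∀ n ≥ N, f n = 0) (z : ℕ) (hz : 0 < z) :
    MvPolynomial.eval (fun _ => (1 : ℚ)) (schurF z N f) =
      ∏ i ∈ Finset.range N, ∏ j ∈ Finset.range (f i),
        ((z : ℚ) + ((j : ℚ) - (i : ℚ))) /
          ((f i : ℚ) - (j : ℚ) + (((Finset.range N).filter fun r => j < f r).card : ℚ)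
            - (i : ℚ) - 1) := by
  set M := ∑ i ∈ range N, f i with hMdef
  have hM : ∀ n ≥ M, f n = 0 := fun n hn => eq_zero_of_sum_le hf hN hn
  have hdet : MvPolynomial.eval (fun _ => (1 : ℚ)) (schurF z N f) =
      (Matrix.of fun i j : Fin M => hOnes z ((f i : ℤ) + (j : ℕ) - (i : ℕ))).det := by
    rw [schurF, RingHom.map_det]
    congr 1
    ext i j
    simp [eval_one_hInt]
  rw [hdet, det_hOnes, prod_range_eq_prod_range_of_eq_one (n := M), ← Fin.prod_univ_eq_prod_range]
  · exact prod_congr rfl fun i _ =>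
      row_factor_eq hf (lt_iff_lt_card_filter hf hN) (hM M le_rfl) z i
  · exact fun i hi => by rw [hN i hi, range_zero, prod_empty]
  · exact fun i hi => by rw [hM i hi, range_zero, prod_empty]
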